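/- Let j_a, j_b, j_c be compatible positive complex structures on (E, ω). Let q denote the projection of E ⊗ ℂ onto E^{1,0}_{j_b} with kernel E^{0,1}_{j_c}, and q̄ the projection of E ⊗ ℂ onto E^{0,1}_{j_b} with kernel E^{1,0}_{j_a} (both well defined since E ⊗ ℂ = E^{1,0}_{j_b} ⊕ E^{0,1}_{j_c} = E^{0,1}_{j_b} ⊕ E^{1,0}_{j_a}). Then the determinant of the ℂ-linear endomorphism q + q̄ of E ⊗ ℂ equals ζ(j_a,j_b,j_c)^{−1}. -/

import Mathlib

open Complex TensorProduct

noncomputable section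

variable {E : Type*} [AddCommGroup E] [Module ℝ E]

/-- `j` is a complex structure on `E`: `j ∘ j = -id`. -/
def IsCplxStruct (j : E →ₗ[ℝ] E) : Prop := ∀ x : E, j (j x) = -x

/-- `j` is compatible with the symplectic form `ω`. -/
def OmCompat (ω : E [⋀^Fin 2]→ₗ[ℝ] ℝ) (j : E →ₗ[ℝ] E) : Prop :=
  ∀ x y : E, ω ![j x, j y] = ω ![x, y]

/-- `j` is positive with respect to `ω`. -/
def OmPos (ω : E [⋀^Fin 2]→ₗ[ℝ] ℝ) (j : E →ₗ[ℝ] E) : Prop :=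
  ∀ x : E, x ≠ 0 → 0 < ω ![x, j x]

/-- `ω` is nondegenerate. -/
def OmNondeg (ω : E [⋀^Fin 2]→ₗ[ℝ] ℝ) : Prop :=
  ∀ x : E, (∀ y : E, ω ![x, y] = 0) → x = 0

/-- The complex conjugate of a `ℂ`-valued alternating form. -/
def conjAlt {p : ℕ} (α : E [⋀^Fin p]→ₗ[ℝ] ℂ) : E [⋀^Fin p]→ₗ[ℝ] ℂ :=
  Complex.conjAe.toLinearMap.compAlternatingMap α

/-- Wedge product of `ℂ`-valued alternating forms. -/
def wedgeC {p q : ℕ} (α : E [⋀^Fin p]→ₗ[ℝ] ℂ) (β : E [⋀^Fin q]→ₗ[ℝ] ℂ) :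
    E [⋀^Fin (p + q)]→ₗ[ℝ] ℂ :=
  ((LinearMap.mul' ℝ ℂ).compAlternatingMap (α.domCoprod β)).domDomCongr finSumFinEquiv

/-- The complexification of a real-valued alternating form. -/
def cplxForm {p : ℕ} (ω : E [⋀^Fin p]→ₗ[ℝ] ℝ) : E [⋀^Fin p]→ₗ[ℝ] ℂ :=
  (Algebra.linearMap ℝ ℂ).compAlternatingMap ω

/-- `ω^{∧ m}`. -/
def omPow (ω : E [⋀^Fin 2]→ₗ[ℝ] ℝ) : (m : ℕ) → E [⋀^Fin (2 * m)]→ₗ[ℝ] ℂ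
  | 0 => (AlternatingMap.constOfIsEmpty ℝ E (Fin 0) 1).domDomCongr (finCongr (by ring))
  | (m + 1) => (wedgeC (cplxForm ω) (omPow ω m)).domDomCongr (finCongr (by ring))

/-- `ω^{∧ n}`, reindexed by `Fin (n + n)`. -/
def topPow (ω : E [⋀^Fin 2]→ₗ[ℝ] ℝ) (n : ℕ) : E [⋀^Fin (n + n)]→ₗ[ℝ] ℂ :=
  (omPow ω n).domDomCongr (finCongr (by ring))

/-- `Λ^{n,0}_j E*`: the space of `ℂ`-valued alternating `p`-forms `α` with
`α (j v₁, v₂, …, v_p) = i • α (v₁, …, v_p)`. -/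
def Lam (j : E →ₗ[ℝ] E) (p : ℕ) : Submodule ℂ (E [⋀^Fin p]→ₗ[ℝ] ℂ) where
  carrier := {α | ∀ (v : Fin p → E) (i : Fin p), (i : ℕ) = 0 →
    α (Function.update v i (j (v i))) = Complex.I * α v}
  add_mem' := by
    intro a b ha hb v i hi
    simp only [AlternatingMap.add_apply, ha v i hi, hb v i hi]
    ring
  zero_mem' := by
    intro v i hi
    simp
  smul_mem' := by
    intro c a ha v i hi
    simp only [AlternatingMap.smul_apply, ha v i hi, smul_eq_mul]
    ring

/-- The scalar `α ∧ β̄ / ω^{∧ n}`. -/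
def pairing (ω : E [⋀^Fin 2]→ₗ[ℝ] ℝ) (n : ℕ) (α β : E [⋀^Fin n]→ₗ[ℝ] ℂ) : ℂ :=
  letI := Classical.propDecidable (∃ c : ℂ, wedgeC α (conjAlt β) = c • topPow ω n)
  if h : ∃ c : ℂ, wedgeC α (conjAlt β) = c • topPow ω n then h.choose else 0

/-- The `ℂ`-linear extension of `j` to the complexification `ℂ ⊗[ℝ] E`. -/
def cplxExt (j : E →ₗ[ℝ] E) : Module.End ℂ (ℂ ⊗[ℝ] E) := j.baseChange ℂ

/-- `E^{1,0}_j`: the `i`-eigenspace of the `ℂ`-linear extension of `j`. -/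
def E10 (j : E →ₗ[ℝ] E) : Submodule ℂ (ℂ ⊗[ℝ] E) :=
  Module.End.eigenspace (cplxExt j) Complex.I

/-- `E^{0,1}_j`: the `(-i)`-eigenspace of the `ℂ`-linear extension of `j`. -/
def E01 (j : E →ₗ[ℝ] E) : Submodule ℂ (ℂ ⊗[ℝ] E) :=
  Module.End.eigenspace (cplxExt j) (-Complex.I)

/-- The defining property of `Ψ_{j_a,j_b}`. -/
def PsiProp (ω : E [⋀^Fin 2]→ₗ[ℝ] ℝ) (n : ℕ) (ja jb : E →ₗ[ℝ] E)
    (Ψ : Lam ja n →ₗ[ℂ] Lam jb n) : Prop :=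
  ∀ α β : Lam ja n,
    wedgeC ((Ψ α : E [⋀^Fin n]→ₗ[ℝ] ℂ)) (conjAlt (β : E [⋀^Fin n]→ₗ[ℝ] ℂ)) =
      wedgeC (α : E [⋀^Fin n]→ₗ[ℝ] ℂ) (conjAlt (β : E [⋀^Fin n]→ₗ[ℝ] ℂ))

/-- The determinant form `v ↦ det (θ i (v j))` of a family of `ℂ`-valued functionals. -/
def detForm {ι : Type*} [Fintype ι] [DecidableEq ι] (θ : ι → E →ₗ[ℝ] ℂ) : E [⋀^ι]→ₗ[ℝ] ℂ :=
  MultilinearMap.alternatization ((MultilinearMap.mkPiAlgebra ℝ ι ℂ).compLinearMap θ)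

theorem detForm_apply {ι : Type*} [Fintype ι] [DecidableEq ι] (θ : ι → E →ₗ[ℝ] ℂ) (v : ι → E) :
    detForm θ v = (Matrix.of fun i j => θ i (v j)).det := by
  rw [← Matrix.det_transpose, Matrix.det_apply, detForm, MultilinearMap.alternatization_apply]
  simp

/-- The complex conjugates of a family of functionals. -/
def conjFamily {ι : Type*} (θ : ι → E →ₗ[ℝ] ℂ) : ι → E →ₗ[ℝ] ℂ :=
  fun i => Complex.conjAe.toLinearMap ∘ₗ θ i

theorem conjAlt_detForm {p : ℕ} (θ : Fin p → E →ₗ[ℝ] ℂ) :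
    conjAlt (detForm θ) = detForm (conjFamily θ) := by
  ext v
  simp only [conjAlt, LinearMap.compAlternatingMap_apply, detForm_apply]
  change (starRingEnd ℂ) _ = _
  rw [RingHom.map_det]
  rfl

theorem wedgeC_detForm {p q : ℕ} (θ : Fin p → E →ₗ[ℝ] ℂ) (φ : Fin q → E →ₗ[ℝ] ℂ) :
    wedgeC (detForm θ) (detForm φ) = (detForm (Sum.elim θ φ)).domDomCongr finSumFinEquiv := by
  rw [wedgeC, detForm, detForm, ← MultilinearMap.domCoprod_alternization,
    ← LinearMap.compMultilinearMap_alternatization, detForm]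
  congr 2
  ext v
  simp [Fintype.prod_sum_type]

theorem det_fromRows_mul_det_add {ι K : Type*} [Fintype ι] [DecidableEq ι] [Field K]
    {A B B' C : Matrix ι (ι ⊕ ι) K} {Q Q' : Matrix (ι ⊕ ι) (ι ⊕ ι) K}
    (hB : B * Q' = 0) (hB' : B' * Q = 0) (hC : C * Q = C) (hA : A * Q' = A)
    (hdet : (Matrix.fromRows B B').det ≠ 0) :
    (Matrix.fromRows C A).det * (Matrix.fromRows B B').det =
      (Matrix.fromRows C B').det * (Matrix.fromRows B A).det * (Q + Q').det := by
  have key : ∀ D : Matrix ι (ι ⊕ ι) K, ∃ X Y : Matrix ι ι K, D = X * B + Y * B' := by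
    intro D
    refine ⟨(D * (Matrix.fromRows B B')⁻¹).toCols₁, (D * (Matrix.fromRows B B')⁻¹).toCols₂, ?_⟩
    rw [← Matrix.fromCols_mul_fromRows, Matrix.fromCols_toCols, Matrix.mul_assoc,
      Matrix.nonsing_inv_mul _ (isUnit_iff_ne_zero.mpr hdet), Matrix.mul_one]
  obtain ⟨X, Y, hXY⟩ := key C
  obtain ⟨Z, W, hZW⟩ := key A
  have h1 : Matrix.fromRows C B' = Matrix.fromBlocks X Y 0 1 * Matrix.fromRows B B' := by
    simp [Matrix.fromBlocks_mul_fromRows, ← hXY]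
  have h2 : Matrix.fromRows B A = Matrix.fromBlocks 1 0 Z W * Matrix.fromRows B B' := by
    simp [Matrix.fromBlocks_mul_fromRows, ← hZW]
  have h3 : Matrix.fromRows C A =
      Matrix.fromBlocks X 0 0 W * (Matrix.fromRows B B' * (Q + Q')) := by
    have hX : X * (B * Q) = C := by
      rw [← hC, hXY]
      simp [Matrix.add_mul, Matrix.mul_assoc, hB']
    have hW : W * (B' * Q') = A := by
      rw [← hA, hZW]
      simp [Matrix.add_mul, Matrix.mul_assoc, hB]
    rw [Matrix.fromRows_mul, Matrix.fromBlocks_mul_fromRows]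
    simp [Matrix.mul_add, hB, hB', hX, hW]
  rw [h1, h2, h3]
  simp only [Matrix.det_mul, Matrix.det_fromBlocks_zero₂₁, Matrix.det_fromBlocks_zero₁₂,
    Matrix.det_one]
  ring

/-- The module structure over `ℂ` defined by a complex structure. -/
abbrev IsCplxStruct.module {j : E →ₗ[ℝ] E} (hj : IsCplxStruct j) : Module ℂ E :=
  Module.compHom E
    (Complex.lift ⟨(j : Module.End ℝ E), LinearMap.ext hj⟩ : ℂ →ₐ[ℝ] Module.End ℝ E).toRingHom

theorem mem_Lam_apply_update {j : E →ₗ[ℝ] E} {n : ℕ} {α : E [⋀^Fin n]→ₗ[ℝ] ℂ}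
    (hα : α ∈ Lam j n) (v : Fin n → E) (i : Fin n) (x : E) :
    α (Function.update v i (j x)) = Complex.I * α (Function.update v i x) := by
  have h0 : 0 < n := i.pos
  have key : ∀ w : Fin n → E, α (Function.update w i (j (w i))) = Complex.I * α w := by
    intro w
    by_cases hi : i = ⟨0, h0⟩
    · exact hα w i (by simp [hi])
    · have := hα (w ∘ Equiv.swap i ⟨0, h0⟩) ⟨0, h0⟩ rfl
      have e : Function.update (w ∘ Equiv.swap i ⟨0, h0⟩) ⟨0, h0⟩
          (j ((w ∘ Equiv.swap i ⟨0, h0⟩) ⟨0, h0⟩)) =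
          Function.update w i (j (w i)) ∘ Equiv.swap i ⟨0, h0⟩ := by
        rw [Function.update_comp_equiv]
        simp
      rw [e, AlternatingMap.map_swap _ _ hi, AlternatingMap.map_swap _ _ hi] at this
      linear_combination -this
  simpa using key (Function.update v i x)

/-- A frame of `(1,0)`-functionals for `j`, separating points, whose determinant form spans
`Lam j n`. -/
theorem exists_frame {n : ℕ} [FiniteDimensional ℝ E] (hdim : Module.finrank ℝ E = 2 * n)
    {j : E →ₗ[ℝ] E} (hj : IsCplxStruct j) :
    ∃ θ : Fin n → E →ₗ[ℝ] ℂ, (∀ i x, θ i (j x) = Complex.I * θ i x) ∧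
      (∀ x, (∀ i, θ i x = 0) → x = 0) ∧ detForm θ ∈ Lam j n ∧
      ∀ α ∈ Lam j n, ∃ c : ℂ, α = c • detForm θ := by
  let := hj.module
  have hsmul : ∀ (c : ℂ) (x : E), c • x = c.re • x + c.im • j x := fun c x => by
    change (Complex.lift ⟨(j : Module.End ℝ E), LinearMap.ext hj⟩ : ℂ →ₐ[ℝ] Module.End ℝ E) c x = _
    simp [Complex.lift, Complex.liftAux_apply]
  have hI : ∀ x : E, j x = Complex.I • x := fun x => by simp [hsmul]
  have : IsScalarTower ℝ ℂ E := ⟨fun r c x => by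
    simp [hsmul, mul_smul]⟩
  have : FiniteDimensional ℂ E := FiniteDimensional.right ℝ ℂ E
  have hfin : Module.finrank ℂ E = n := by
    have := Module.finrank_mul_finrank ℝ ℂ E
    rw [Complex.finrank_real_complex, hdim] at this
    omega
  let e : Module.Basis (Fin n) ℂ E := Module.finBasisOfFinrankEq ℂ E hfin
  let θ : Fin n → E →ₗ[ℝ] ℂ := fun i => (e.coord i).restrictScalars ℝ
  have hdet : ∀ v, detForm θ v = e.det v := fun v => by
    rw [detForm_apply, Module.Basis.det_apply]; rfl
  refine ⟨θ, fun i x => ?_, fun x hx => ?_, fun v i _ => ?_, fun α hα => ?_⟩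
  · simp [θ, hI]
  · exact e.ext_elem fun i => by simpa [θ] using hx i
  · rw [hdet, hdet, hI, AlternatingMap.map_update_smul, Function.update_eq_self, smul_eq_mul]
  · let α' : E [⋀^Fin n]→ₗ[ℂ] ℂ :=
      { toFun := α
        map_update_add' := α.map_update_add'
        map_update_smul' := by
          intro inst v i c x
          obtain rfl : inst = instDecidableEqFin n := Subsingleton.elim _ _
          change α (Function.update v i (c • x)) = c * α (Function.update v i x)
          rw [hsmul, α.map_update_add, α.map_update_smul, α.map_update_smul,
            mem_Lam_apply_update hα v i x]
          conv_rhs => rw [← Complex.re_add_im c]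
          simp only [Complex.real_smul]
          ring
        map_eq_zero_of_eq' := fun v i k h hik => α.map_eq_zero_of_eq v h hik }
    refine ⟨α e, AlternatingMap.ext fun v => ?_⟩
    have : α v = α e * e.det v := congrArg (fun f => f v) (α'.eq_smul_basis_det e)
    rw [this, AlternatingMap.smul_apply, hdet, smul_eq_mul]

theorem liftBaseChange_eq_zero {j : E →ₗ[ℝ] E} {φ : E →ₗ[ℝ] ℂ} {s t : ℂ} (hst : s ≠ t)
    (hφ : ∀ x, φ (j x) = s * φ x) {x : ℂ ⊗[ℝ] E} (hx : cplxExt j x = t • x) :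
    φ.liftBaseChange ℂ x = 0 := by
  have h : φ.liftBaseChange ℂ ∘ₗ cplxExt j = s • φ.liftBaseChange ℂ := by
    ext y
    simp [cplxExt, hφ]
  have h' := LinearMap.congr_fun h x
  rw [LinearMap.comp_apply, hx, map_smul, LinearMap.smul_apply, smul_eq_mul, smul_eq_mul] at h'
  exact (mul_eq_zero.mp (by linear_combination h' : (t - s) * _ = 0)).resolve_left
    (sub_ne_zero.mpr hst.symm)

/-- The matrix of values of a family of functionals on a family of vectors. -/
def evalMatrix {ι κ : Type*} (b : κ → E) (θ : ι → E →ₗ[ℝ] ℂ) : Matrix ι κ ℂ :=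
  Matrix.of fun i k => θ i (b k)

theorem evalMatrix_mul_toMatrix {ι κ : Type*} [Fintype κ] [DecidableEq κ]
    (b : Module.Basis κ ℝ E) (θ φ : ι → E →ₗ[ℝ] ℂ) (q : (ℂ ⊗[ℝ] E) →ₗ[ℂ] (ℂ ⊗[ℝ] E))
    (h : ∀ i x, (θ i).liftBaseChange ℂ (q x) = (φ i).liftBaseChange ℂ x) :
    evalMatrix b θ * LinearMap.toMatrix (b.baseChange ℂ) (b.baseChange ℂ) q =
      evalMatrix b φ := by
  ext i k
  have h1 : φ i (b k) = (φ i).liftBaseChange ℂ (b.baseChange ℂ k) := by simp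
  rw [Matrix.mul_apply, evalMatrix, evalMatrix, Matrix.of_apply, h1, ← h,
    ← (b.baseChange ℂ).sum_repr (q (b.baseChange ℂ k)), map_sum]
  refine Finset.sum_congr rfl fun l _ => ?_
  simp [LinearMap.toMatrix_apply, mul_comm]

theorem det_evalMatrix_conj_ne_zero {ι : Type*} [Fintype ι] [DecidableEq ι]
    (b : Module.Basis (ι ⊕ ι) ℝ E) (θ : ι → E →ₗ[ℝ] ℂ) (hθ : ∀ x, (∀ i, θ i x = 0) → x = 0) :
    (Matrix.fromRows (evalMatrix b θ) (evalMatrix b (conjFamily θ))).det ≠ 0 := by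
  intro h
  obtain ⟨v, hv0, hv⟩ := Matrix.exists_mulVec_eq_zero_iff.mpr h
  rw [Matrix.fromRows_mulVec] at hv
  have h1 : ∀ i, ∑ k, θ i (b k) * v k = 0 := fun i => congrFun hv (Sum.inl i)
  have h2 : ∀ i, ∑ k, (starRingEnd ℂ) (θ i (b k)) * v k = 0 := fun i => congrFun hv (Sum.inr i)
  have h3 : ∀ i, ∑ k, θ i (b k) * (starRingEnd ℂ) (v k) = 0 := fun i => by
    simpa using congrArg (starRingEnd ℂ) (h2 i)
  have zero_of : ∀ r : ι ⊕ ι → ℝ, (∀ i, ∑ k, θ i (b k) * (r k : ℂ) = 0) → r = 0 := by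
    intro r hr
    have : ∑ k, r k • b k = 0 := hθ _ fun i => by
      rw [map_sum, ← hr i]
      exact Finset.sum_congr rfl fun k _ => by simp [mul_comm]
    exact funext (Fintype.linearIndependent_iff.mp b.linearIndependent r this)
  have hre : (fun k => (v k).re) = 0 := zero_of _ fun i => by
    have : ∑ k, θ i (b k) * ((v k).re : ℂ) =
        (∑ k, θ i (b k) * v k + ∑ k, θ i (b k) * (starRingEnd ℂ) (v k)) / 2 := by
      rw [← Finset.sum_add_distrib, Finset.sum_div]
      exact Finset.sum_congr rfl fun k _ => by rw [Complex.re_eq_add_conj]; ring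
    rw [this, h1, h3]; simp
  have him : (fun k => (v k).im) = 0 := zero_of _ fun i => by
    have : ∑ k, θ i (b k) * ((v k).im : ℂ) =
        (∑ k, θ i (b k) * v k - ∑ k, θ i (b k) * (starRingEnd ℂ) (v k)) / (2 * Complex.I) := by
      rw [← Finset.sum_sub_distrib, Finset.sum_div]
      exact Finset.sum_congr rfl fun k _ => by rw [Complex.im_eq_sub_conj]; ring
    rw [this, h1, h3]; simp
  exact hv0 (funext fun k => Complex.ext (congrFun hre k) (congrFun him k))

theorem wedgeC_detForm_conjAlt_apply {n : ℕ} (b : Fin n ⊕ Fin n → E) (θ φ : Fin n → E →ₗ[ℝ] ℂ) :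
    wedgeC (detForm θ) (conjAlt (detForm φ)) (b ∘ finSumFinEquiv.symm) =
      (Matrix.fromRows (evalMatrix b θ) (evalMatrix b (conjFamily φ))).det := by
  rw [conjAlt_detForm, wedgeC_detForm, AlternatingMap.domDomCongr_apply, detForm_apply]
  congr 1
  ext (i | i) k <;> simp [evalMatrix, conjFamily]

theorem wedgeC_smul_left {p q : ℕ} (c : ℂ) (α : E [⋀^Fin p]→ₗ[ℝ] ℂ) (β : E [⋀^Fin q]→ₗ[ℝ] ℂ) :
    wedgeC (c • α) β = c • wedgeC α β := by
  ext v
  simp only [wedgeC, AlternatingMap.domDomCongr_apply, LinearMap.compAlternatingMap_apply,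
    AlternatingMap.domCoprod_apply, sum_apply, AlternatingMap.smul_apply, map_sum,
    Finset.smul_sum]
  refine Finset.sum_congr rfl fun σ _ => ?_
  induction σ using Quotient.inductionOn with
  | _ σ =>
    rcases Int.units_eq_one_or (Equiv.Perm.sign σ) with h | h <;>
      simp [AlternatingMap.domCoprod.summand_mk'', h, mul_assoc]

theorem PsiProp.smul_det_eq {n : ℕ} {ω : E [⋀^Fin 2]→ₗ[ℝ] ℝ} {ja jb : E →ₗ[ℝ] E}
    {Ψ : Lam ja n →ₗ[ℂ] Lam jb n} (hΨ : PsiProp ω n ja jb Ψ) {θa θb : Fin n → E →ₗ[ℝ] ℂ}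
    (ha : detForm θa ∈ Lam ja n) {c : ℂ}
    (hc : (Ψ ⟨detForm θa, ha⟩ : E [⋀^Fin n]→ₗ[ℝ] ℂ) = c • detForm θb)
    (b : Fin n ⊕ Fin n → E) :
    c * (Matrix.fromRows (evalMatrix b θb) (evalMatrix b (conjFamily θa))).det =
      (Matrix.fromRows (evalMatrix b θa) (evalMatrix b (conjFamily θa))).det := by
  have h := congrArg (fun f => f (b ∘ finSumFinEquiv.symm))
    (hΨ ⟨detForm θa, ha⟩ ⟨detForm θa, ha⟩)
  simpa [hc, wedgeC_smul_left, wedgeC_detForm_conjAlt_apply] using h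

/-- `det (q + q̄) = ζ(j_a,j_b,j_c)⁻¹`, where `q` is the projection
of `E ⊗ ℂ` onto `E^{1,0}_{j_b}` with kernel `E^{0,1}_{j_c}` and `q̄` is the
projection onto `E^{0,1}_{j_b}` with kernel `E^{1,0}_{j_a}`. -/
theorem statement12 {E : Type*} [AddCommGroup E] [Module ℝ E] [FiniteDimensional ℝ E]
    (n : ℕ) (hn : 0 < n) (ω : E [⋀^Fin 2]→ₗ[ℝ] ℝ)
    (hdim : Module.finrank ℝ E = 2 * n) (hnd : OmNondeg ω)
    (ja jb jc : E →ₗ[ℝ] E)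
    (hja : IsCplxStruct ja) (hjb : IsCplxStruct jb) (hjc : IsCplxStruct jc)
    (hca : OmCompat ω ja) (hcb : OmCompat ω jb) (hcc : OmCompat ω jc)
    (hpa : OmPos ω ja) (hpb : OmPos ω jb) (hpc : OmPos ω jc)
    -- `q` : the projection onto `E^{1,0}_{j_b}` with kernel `E^{0,1}_{j_c}`
    (q : (ℂ ⊗[ℝ] E) →ₗ[ℂ] (ℂ ⊗[ℝ] E))
    (hq : ∀ x : ℂ ⊗[ℝ] E, q x ∈ E10 jb ∧ x - q x ∈ E01 jc)
    -- `q̄` : the projection onto `E^{0,1}_{j_b}` with kernel `E^{1,0}_{j_a}`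
    (qbar : (ℂ ⊗[ℝ] E) →ₗ[ℂ] (ℂ ⊗[ℝ] E))
    (hqbar : ∀ x : ℂ ⊗[ℝ] E, qbar x ∈ E01 jb ∧ x - qbar x ∈ E10 ja)
    -- the maps `Ψ` and the scalar `ζ(j_a,j_b,j_c)`
    (Ψab : Lam ja n →ₗ[ℂ] Lam jb n) (hΨab : PsiProp ω n ja jb Ψab)
    (Ψbc : Lam jb n →ₗ[ℂ] Lam jc n) (hΨbc : PsiProp ω n jb jc Ψbc)
    (Ψac : Lam ja n →ₗ[ℂ] Lam jc n) (hΨac : PsiProp ω n ja jc Ψac)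
    (z : ℂ) (hz : Ψac = z • (Ψbc ∘ₗ Ψab)) :
    LinearMap.det (q + qbar) = z⁻¹ := by
  obtain ⟨θa, hIa, hsa, hLa, hga⟩ := exists_frame hdim hja
  obtain ⟨θb, hIb, hsb, hLb, hgb⟩ := exists_frame hdim hjb
  obtain ⟨θc, hIc, hsc, hLc, hgc⟩ := exists_frame hdim hjc
  obtain ⟨cab, hcab⟩ := hgb _ (Ψab ⟨detForm θa, hLa⟩).2
  obtain ⟨cbc, hcbc⟩ := hgc _ (Ψbc ⟨detForm θb, hLb⟩).2
  obtain ⟨cac, hcac⟩ := hgc _ (Ψac ⟨detForm θa, hLa⟩).2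
  let b : Module.Basis (Fin n ⊕ Fin n) ℝ E :=
    (Module.finBasisOfFinrankEq ℝ E (hdim.trans (two_mul n))).reindex finSumFinEquiv.symm
  have eab := hΨab.smul_det_eq hLa hcab b
  have ebc := hΨbc.smul_det_eq hLb hcbc b
  have eac := hΨac.smul_det_eq hLa hcac b
  have hconj : ∀ {j : E →ₗ[ℝ] E} {θ : Fin n → E →ₗ[ℝ] ℂ},
      (∀ i x, θ i (j x) = Complex.I * θ i x) →
      ∀ i x, conjFamily θ i (j x) = -Complex.I * conjFamily θ i x := fun h i x => by
    simp [conjFamily, h]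
  have hne : Complex.I ≠ -Complex.I := fun h => Complex.I_ne_zero (self_eq_neg.mp h)
  have hcoef : cac = z * cbc * cab := by
    have h : (Ψac ⟨detForm θa, hLa⟩ : E [⋀^Fin n]→ₗ[ℝ] ℂ) = (z * cbc * cab) • detForm θc := by
      have h1 : Ψab ⟨detForm θa, hLa⟩ = cab • ⟨detForm θb, hLb⟩ := Subtype.ext hcab
      rw [hz, LinearMap.smul_apply, LinearMap.comp_apply, h1, map_smul, Submodule.coe_smul,
        Submodule.coe_smul, hcbc, smul_smul, smul_smul]
      congr 1
      ring
    have e := hΨac.smul_det_eq hLa h b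
    have hD := det_evalMatrix_conj_ne_zero b θa hsa
    rw [← eac] at e hD
    exact mul_right_cancel₀ (right_ne_zero_of_mul hD) e.symm
  have hT := det_fromRows_mul_det_add
    (A := evalMatrix b (conjFamily θa)) (B := evalMatrix b θb)
    (B' := evalMatrix b (conjFamily θb)) (C := evalMatrix b θc)
    (Q := LinearMap.toMatrix (b.baseChange ℂ) (b.baseChange ℂ) q)
    (Q' := LinearMap.toMatrix (b.baseChange ℂ) (b.baseChange ℂ) qbar)
    ((evalMatrix_mul_toMatrix b θb 0 qbar fun i x => by
      rw [liftBaseChange_eq_zero hne (hIb i) (Module.End.mem_eigenspace_iff.mp (hqbar x).1)]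
      simp).trans (by ext; rfl))
    ((evalMatrix_mul_toMatrix b (conjFamily θb) 0 q fun i x => by
      rw [liftBaseChange_eq_zero hne.symm (hconj hIb i)
        (Module.End.mem_eigenspace_iff.mp (hq x).1)]
      simp).trans (by ext; rfl))
    (evalMatrix_mul_toMatrix b θc θc q fun i x => by
      have := liftBaseChange_eq_zero hne (hIc i) (Module.End.mem_eigenspace_iff.mp (hq x).2)
      rw [map_sub] at this
      exact (sub_eq_zero.mp this).symm)
    (evalMatrix_mul_toMatrix b (conjFamily θa) (conjFamily θa) qbar fun i x => by
      have := liftBaseChange_eq_zero hne.symm (hconj hIa i)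
        (Module.End.mem_eigenspace_iff.mp (hqbar x).2)
      rw [map_sub] at this
      exact (sub_eq_zero.mp this).symm)
    (det_evalMatrix_conj_ne_zero b θb hsb)
  rw [← map_add, LinearMap.det_toMatrix] at hT
  have hDa := det_evalMatrix_conj_ne_zero b θa hsa
  have hDb := det_evalMatrix_conj_ne_zero b θb hsb
  rw [← eab] at hDa
  have hcab0 := left_ne_zero_of_mul hDa
  have hDba := right_ne_zero_of_mul hDa
  rw [← ebc] at hDb hT
  have hcbc0 := left_ne_zero_of_mul hDb
  have hDcb := right_ne_zero_of_mul hDb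
  rw [← eab, hcoef] at eac
  refine eq_inv_of_mul_eq_one_left ?_
  refine mul_left_cancel₀ (mul_ne_zero (mul_ne_zero hcab0 hcbc0) (mul_ne_zero hDcb hDba)) ?_
  linear_combination (-z * cbc * cab) * hT + cbc *
    (Matrix.fromRows (evalMatrix b θc) (evalMatrix b (conjFamily θb))).det * eac

end
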